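/- Let A, B, C be three non-collinear points in ℝ². If there exists an open ball (with positive radius) contained in the convex hull of {A, B, C} on which the distance sum function V is constant, then the triangle is equilateral: dist A B = dist B C = dist C A. -/

import Mathlib

noncomputable def lineDist (P A B : EuclideanSpace ℝ (Fin 2)) : ℝ :=
  Metric.infDist P (affineSpan ℝ {A, B} : Set (EuclideanSpace ℝ (Fin 2)))

noncomputable def distSum (A B C P : EuclideanSpace ℝ (Fin 2)) : ℝ :=
  lineDist P A B + lineDist P B C + lineDist P C A

/-- The determinant of the pair of plane vectors `X - A`, `Y - A`, i.e. twice the signed area of the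
triangle `A X Y`. -/
def signedDoubleArea (A X Y : EuclideanSpace ℝ (Fin 2)) : ℝ :=
  (X 0 - A 0) * (Y 1 - A 1) - (X 1 - A 1) * (Y 0 - A 0)

lemma dist_sq_eq_coord (A B : EuclideanSpace ℝ (Fin 2)) :
    dist A B ^ 2 = (A 0 - B 0) ^ 2 + (A 1 - B 1) ^ 2 := by
  rw [EuclideanSpace.dist_eq, Real.sq_sqrt (by positivity)]
  simp [Fin.sum_univ_two, Real.dist_eq, sq_abs]

lemma lineDist_eq_abs_div {A B : EuclideanSpace ℝ (Fin 2)} (hAB : A ≠ B)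
    (P : EuclideanSpace ℝ (Fin 2)) :
    lineDist P A B = |signedDoubleArea A B P| / dist A B := by
  have hd : 0 < dist A B := dist_pos.2 hAB
  have hnonneg : 0 ≤ lineDist P A B := Metric.infDist_nonneg
  rw [eq_div_iff hd.ne', ← abs_of_nonneg (mul_nonneg hnonneg hd.le), ← sq_eq_sq_iff_abs_eq_abs]
  set s := affineSpan ℝ {A, B}
  have : Nonempty s := ⟨⟨A, left_mem_affineSpan_pair ℝ A B⟩⟩
  have hdist : dist P (EuclideanGeometry.orthogonalProjection s P) = lineDist P A B :=
    EuclideanGeometry.dist_orthogonalProjection_eq_infDist s P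
  have hinner := (Submodule.mem_orthogonal _ _).1
    (EuclideanGeometry.vsub_orthogonalProjection_mem_direction_orthogonal s P) (B -ᵥ A)
    (AffineSubspace.vsub_mem_direction (right_mem_affineSpan_pair ℝ A B)
      (left_mem_affineSpan_pair ℝ A B))
  obtain ⟨t, ht⟩ := mem_affineSpan_pair_iff_exists_lineMap_eq.1
    (EuclideanGeometry.orthogonalProjection_mem (s := s) P)
  rw [← hdist, ← ht, mul_pow, dist_sq_eq_coord, dist_sq_eq_coord]
  rw [← ht] at hinner
  simp [AffineMap.lineMap_apply, PiLp.inner_apply, Fin.sum_univ_two] at hinner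
  simp [AffineMap.lineMap_apply, signedDoubleArea]
  linear_combination ((P 0 - (t * (B 0 - A 0) + A 0)) * (B 0 - A 0) +
    (P 1 - (t * (B 1 - A 1) + A 1)) * (B 1 - A 1)) * hinner

lemma exists_signedDoubleArea_eq_mul {A B C P : EuclideanSpace ℝ (Fin 2)}
    (hP : P ∈ convexHull ℝ ({A, B, C} : Set (EuclideanSpace ℝ (Fin 2)))) :
    ∃ a b c : ℝ, 0 ≤ a ∧ 0 ≤ b ∧ 0 ≤ c ∧
      signedDoubleArea A B P = c * signedDoubleArea A B C ∧
      signedDoubleArea B C P = a * signedDoubleArea A B C ∧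
      signedDoubleArea C A P = b * signedDoubleArea A B C := by
  rw [convexHull_insert (by simp), convexHull_pair] at hP
  simp only [convexJoin_singleton_left, Set.mem_iUnion] at hP
  obtain ⟨Q, ⟨b, c, hb, hc, hbc, rfl⟩, ⟨u, v, hu, hv, huv, rfl⟩⟩ := hP
  obtain rfl : b = 1 - c := by linarith
  obtain rfl : u = 1 - v := by linarith
  refine ⟨1 - v, v * (1 - c), v * c, hu, mul_nonneg hv hb, mul_nonneg hv hc, ?_, ?_, ?_⟩ <;>
  · simp [signedDoubleArea]
    ring

lemma distSum_mul_signedDoubleArea {A B C P : EuclideanSpace ℝ (Fin 2)}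
    (hAB : A ≠ B) (hBC : B ≠ C) (hCA : C ≠ A)
    (hP : P ∈ convexHull ℝ ({A, B, C} : Set (EuclideanSpace ℝ (Fin 2)))) :
    distSum A B C P * signedDoubleArea A B C = |signedDoubleArea A B C| *
      (signedDoubleArea A B P / dist A B + signedDoubleArea B C P / dist B C +
        signedDoubleArea C A P / dist C A) := by
  obtain ⟨a, b, c, ha, hb, hc, h₁, h₂, h₃⟩ := exists_signedDoubleArea_eq_mul hP
  rw [distSum, lineDist_eq_abs_div hAB, lineDist_eq_abs_div hBC, lineDist_eq_abs_div hCA,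
    h₁, h₂, h₃, abs_mul, abs_mul, abs_mul, abs_of_nonneg ha, abs_of_nonneg hb, abs_of_nonneg hc]
  ring

lemma collinear_of_signedDoubleArea_eq_zero {A B C : EuclideanSpace ℝ (Fin 2)} (hAB : A ≠ B)
    (h : signedDoubleArea A B C = 0) :
    Collinear ℝ ({A, B, C} : Set (EuclideanSpace ℝ (Fin 2))) := by
  have hd : 0 < dist A B := dist_pos.2 hAB
  have hd2 : (A 0 - B 0) ^ 2 + (A 1 - B 1) ^ 2 ≠ 0 := by
    rw [← dist_sq_eq_coord]; positivity
  rw [collinear_iff_of_mem (p₀ := A) (by simp)]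
  refine ⟨B - A, ?_⟩
  rintro p (rfl | rfl | rfl)
  · exact ⟨0, by simp⟩
  · exact ⟨1, by simp⟩
  · refine ⟨((B 0 - A 0) * (p 0 - A 0) + (B 1 - A 1) * (p 1 - A 1)) /
      ((A 0 - B 0) ^ 2 + (A 1 - B 1) ^ 2), ?_⟩
    unfold signedDoubleArea at h
    ext i
    fin_cases i
    · simp
      field_simp
      linear_combination (-(B 1 - A 1)) * h
    · simp
      field_simp
      linear_combination (B 0 - A 0) * h

theorem equilateral_of_distSum_const_on_ball
    (A B C : EuclideanSpace ℝ (Fin 2))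
    (hncol : ¬ Collinear ℝ ({A, B, C} : Set (EuclideanSpace ℝ (Fin 2))))
    (c : EuclideanSpace ℝ (Fin 2)) (r : ℝ) (hr : 0 < r)
    (hsub : Metric.ball c r ⊆ convexHull ℝ ({A, B, C} : Set (EuclideanSpace ℝ (Fin 2))))
    (h : ℝ) (hconst : ∀ P ∈ Metric.ball c r, distSum A B C P = h) :
    dist A B = dist B C ∧ dist B C = dist C A := by
  have hAB : A ≠ B := by
    rintro rfl
    exact hncol (by simpa using collinear_pair ℝ A C)
  have hBC : B ≠ C := by
    rintro rfl
    exact hncol (by simpa using collinear_pair ℝ A B)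
  have hCA : C ≠ A := by
    rintro rfl
    exact hncol (by simpa [Set.pair_comm] using collinear_pair ℝ B C)
  have hS : signedDoubleArea A B C ≠ 0 := fun h₀ =>
    hncol (collinear_of_signedDoubleArea_eq_zero hAB h₀)
  have hdAB := dist_pos.2 hAB
  have hdBC := dist_pos.2 hBC
  have hdCA := dist_pos.2 hCA
  have key (v : EuclideanSpace ℝ (Fin 2)) :
      ((B 0 - A 0) * v 1 - (B 1 - A 1) * v 0) / dist A B +
        ((C 0 - B 0) * v 1 - (C 1 - B 1) * v 0) / dist B C +
        ((A 0 - C 0) * v 1 - (A 1 - C 1) * v 0) / dist C A = 0 := by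
    obtain ⟨t, ht, htv⟩ : ∃ t : ℝ, 0 < t ∧ t * ‖v‖ < r := by
      refine ⟨r / (‖v‖ + 1), by positivity, ?_⟩
      rw [div_mul_eq_mul_div, div_lt_iff₀ (by positivity)]
      nlinarith
    have hc : c ∈ Metric.ball c r := Metric.mem_ball_self hr
    have hc' : c + t • v ∈ Metric.ball c r := by
      simpa [norm_smul, abs_of_pos ht] using htv
    have e := distSum_mul_signedDoubleArea hAB hBC hCA (hsub hc)
    have e' := distSum_mul_signedDoubleArea hAB hBC hCA (hsub hc')
    rw [hconst _ hc] at e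
    rw [hconst _ hc', e] at e'
    have e'' := mul_left_cancel₀ (abs_ne_zero.2 hS) e'
    refine mul_left_cancel₀ ht.ne' ?_
    simp only [signedDoubleArea, PiLp.add_apply, PiLp.smul_apply, smul_eq_mul] at e''
    linear_combination -e''
  have inv_eq {x y : ℝ} (hxy : signedDoubleArea A B C * (x⁻¹ - y⁻¹) = 0) : x = y :=
    inv_injective (sub_eq_zero.1 ((mul_eq_zero.1 hxy).resolve_left hS))
  have hBC_CA : dist B C = dist C A := by
    have e := key (B - A)
    refine inv_eq ?_
    simp only [PiLp.sub_apply] at e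
    unfold signedDoubleArea
    linear_combination -e
  refine ⟨?_, hBC_CA⟩
  rw [hBC_CA]
  have e := key (C - B)
  refine inv_eq ?_
  simp only [PiLp.sub_apply] at e
  unfold signedDoubleArea
  linear_combination e
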